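/- Let (M,𝒳) ⊨ RCA0, ℱ the class of total functions M→M in 𝒳, and 𝒰 an ultrafilter on 𝒳 all of whose elements are cofinal in M. Then the second-order restricted ultrapower (ℱ/𝒰,𝒳) is a Σ2^0-elementary extension of (M,𝒳): every Σ2^0 formula with parameters from (M,𝒳) is absolute between (M,𝒳) and (ℱ/𝒰,𝒳). -/

import Mathlib

namespace PaperArith

/-! ## Syntax of (two-sorted) first-order arithmetic

Terms and formulas of arithmetic in the language `{0, 1, +, ·, <}`,
with number variables and (monadic second-order) set variables both indexed
by natural numbers.  Bounded quantifiers are taken as primitives, so that the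
class `Δ₀` of bounded formulas is a purely syntactic class. -/

/-- Terms of first-order arithmetic in the language `{0, 1, +, ·, <}`. -/
inductive Term : Type
  | var : ℕ → Term
  | zero : Term
  | one : Term
  | add : Term → Term → Term
  | mul : Term → Term → Term

/-- Formulas of (two-sorted) arithmetic.  `mem t i` is the atomic formula
`t ∈ Xᵢ`; `ball x t φ` is `∀ x < t, φ` and `bex x t φ` is `∃ x < t, φ`;
`sall i φ` and `sex i φ` quantify over the set variable `Xᵢ`.
Purely first-order formulas are those avoiding `mem`, `sall`, `sex`. -/
inductive Fml : Type
  | eq : Term → Term → Fml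
  | lt : Term → Term → Fml
  | mem : Term → ℕ → Fml
  | not : Fml → Fml
  | and : Fml → Fml → Fml
  | or : Fml → Fml → Fml
  | imp : Fml → Fml → Fml
  | all : ℕ → Fml → Fml
  | ex : ℕ → Fml → Fml
  | ball : ℕ → Term → Fml → Fml
  | bex : ℕ → Term → Fml → Fml
  | sall : ℕ → Fml → Fml
  | sex : ℕ → Fml → Fml

/-- A structure for the first-order language of arithmetic. -/
structure Str : Type 1 where
  M : Type
  zero : M
  one : M
  add : M → M → M
  mul : M → M → M
  lt : M → M → Prop

/-- Value of a term under a valuation of the number variables. -/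
def tval (S : Str) (v : ℕ → S.M) : Term → S.M
  | .var i => v i
  | .zero => S.zero
  | .one => S.one
  | .add t u => S.add (tval S v t) (tval S v u)
  | .mul t u => S.mul (tval S v t) (tval S v u)

/-- Update a valuation at one variable. -/
def upd {α : Type} (v : ℕ → α) (x : ℕ) (a : α) : ℕ → α :=
  fun i => if i = x then a else v i

/-- Tarskian satisfaction over the structure `S`, with second-order universe
`X` (set quantifiers range over `X`); `v` is the valuation of number
variables, `w` the valuation of set variables. -/
def Sat (S : Str) (X : Set (Set S.M)) : (ℕ → S.M) → (ℕ → Set S.M) → Fml → Prop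
  | v, _, .eq t u => tval S v t = tval S v u
  | v, _, .lt t u => S.lt (tval S v t) (tval S v u)
  | v, w, .mem t i => tval S v t ∈ w i
  | v, w, .not φ => ¬ Sat S X v w φ
  | v, w, .and φ ψ => Sat S X v w φ ∧ Sat S X v w ψ
  | v, w, .or φ ψ => Sat S X v w φ ∨ Sat S X v w ψ
  | v, w, .imp φ ψ => Sat S X v w φ → Sat S X v w ψ
  | v, w, .all x φ => ∀ m : S.M, Sat S X (upd v x m) w φ
  | v, w, .ex x φ => ∃ m : S.M, Sat S X (upd v x m) w φ
  | v, w, .ball x t φ => ∀ m : S.M, S.lt m (tval S v t) → Sat S X (upd v x m) w φ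
  | v, w, .bex x t φ => ∃ m : S.M, S.lt m (tval S v t) ∧ Sat S X (upd v x m) w φ
  | v, w, .sall i φ => ∀ A : Set S.M, A ∈ X → Sat S X v (upd w i A) φ
  | v, w, .sex i φ => ∃ A : Set S.M, A ∈ X ∧ Sat S X v (upd w i A) φ

/-- First-order satisfaction (for purely first-order formulas the second-order
data is irrelevant). -/
def Sat0 (S : Str) (v : ℕ → S.M) (φ : Fml) : Prop :=
  Sat S ∅ v (fun _ => ∅) φ

/-! ## The arithmetic hierarchy -/

/-- `Δ₀` formulas: purely first-order, only bounded quantifiers. -/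
inductive Delta0 : Fml → Prop
  | eq (t u : Term) : Delta0 (.eq t u)
  | lt (t u : Term) : Delta0 (.lt t u)
  | not {φ : Fml} : Delta0 φ → Delta0 (.not φ)
  | and {φ ψ : Fml} : Delta0 φ → Delta0 ψ → Delta0 (.and φ ψ)
  | or {φ ψ : Fml} : Delta0 φ → Delta0 ψ → Delta0 (.or φ ψ)
  | imp {φ ψ : Fml} : Delta0 φ → Delta0 ψ → Delta0 (.imp φ ψ)
  | ball (x : ℕ) (t : Term) {φ : Fml} : Delta0 φ → Delta0 (.ball x t φ)
  | bex (x : ℕ) (t : Term) {φ : Fml} : Delta0 φ → Delta0 (.bex x t φ)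

mutual
  /-- `Σₙ` formulas of the first-order arithmetic hierarchy. -/
  inductive IsSigma : ℕ → Fml → Prop
    | delta0 {n : ℕ} {φ : Fml} : Delta0 φ → IsSigma n φ
    | ofPi {n : ℕ} {φ : Fml} : IsPi n φ → IsSigma (n + 1) φ
    | ex (x : ℕ) {n : ℕ} {φ : Fml} : IsSigma (n + 1) φ → IsSigma (n + 1) (.ex x φ)
  /-- `Πₙ` formulas of the first-order arithmetic hierarchy. -/
  inductive IsPi : ℕ → Fml → Prop
    | delta0 {n : ℕ} {φ : Fml} : Delta0 φ → IsPi n φ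
    | ofSigma {n : ℕ} {φ : Fml} : IsSigma n φ → IsPi (n + 1) φ
    | all (x : ℕ) {n : ℕ} {φ : Fml} : IsPi (n + 1) φ → IsPi (n + 1) (.all x φ)
end

/-- `Σ₀(Σₙ)`: the closure of `Σₙ` under Boolean operations and bounded
quantification. -/
inductive Sigma0Sigma (n : ℕ) : Fml → Prop
  | ofSigma {φ : Fml} : IsSigma n φ → Sigma0Sigma n φ
  | not {φ : Fml} : Sigma0Sigma n φ → Sigma0Sigma n (.not φ)
  | and {φ ψ : Fml} : Sigma0Sigma n φ → Sigma0Sigma n ψ → Sigma0Sigma n (.and φ ψ)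
  | or {φ ψ : Fml} : Sigma0Sigma n φ → Sigma0Sigma n ψ → Sigma0Sigma n (.or φ ψ)
  | imp {φ ψ : Fml} : Sigma0Sigma n φ → Sigma0Sigma n ψ → Sigma0Sigma n (.imp φ ψ)
  | ball (x : ℕ) (t : Term) {φ : Fml} : Sigma0Sigma n φ → Sigma0Sigma n (.ball x t φ)
  | bex (x : ℕ) (t : Term) {φ : Fml} : Sigma0Sigma n φ → Sigma0Sigma n (.bex x t φ)

/-- The class `Σₙ ∧ Πₙ` of conjunctions of a `Σₙ` and a `Πₙ` formula. -/
def SigmaAndPi (n : ℕ) (φ : Fml) : Prop :=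
  ∃ ψ χ : Fml, IsSigma n ψ ∧ IsPi n χ ∧ φ = Fml.and ψ χ

/-- The class `Σₙ ∨ Πₙ` of disjunctions of a `Σₙ` and a `Πₙ` formula. -/
def SigmaOrPi (n : ℕ) (φ : Fml) : Prop :=
  ∃ ψ χ : Fml, IsSigma n ψ ∧ IsPi n χ ∧ φ = Fml.or ψ χ

/-- `Δ₀⁰` formulas of second-order arithmetic: only bounded first-order
quantifiers; free set variables (set parameters) are allowed. -/
inductive Delta0SO : Fml → Prop
  | eq (t u : Term) : Delta0SO (.eq t u)
  | lt (t u : Term) : Delta0SO (.lt t u)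
  | mem (t : Term) (i : ℕ) : Delta0SO (.mem t i)
  | not {φ : Fml} : Delta0SO φ → Delta0SO (.not φ)
  | and {φ ψ : Fml} : Delta0SO φ → Delta0SO ψ → Delta0SO (.and φ ψ)
  | or {φ ψ : Fml} : Delta0SO φ → Delta0SO ψ → Delta0SO (.or φ ψ)
  | imp {φ ψ : Fml} : Delta0SO φ → Delta0SO ψ → Delta0SO (.imp φ ψ)
  | ball (x : ℕ) (t : Term) {φ : Fml} : Delta0SO φ → Delta0SO (.ball x t φ)
  | bex (x : ℕ) (t : Term) {φ : Fml} : Delta0SO φ → Delta0SO (.bex x t φ)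

mutual
  /-- `Σₙ⁰` formulas of the second-order arithmetic hierarchy
  (set parameters allowed, no set quantifiers). -/
  inductive SigmaSO : ℕ → Fml → Prop
    | delta0 {n : ℕ} {φ : Fml} : Delta0SO φ → SigmaSO n φ
    | ofPi {n : ℕ} {φ : Fml} : PiSO n φ → SigmaSO (n + 1) φ
    | ex (x : ℕ) {n : ℕ} {φ : Fml} : SigmaSO (n + 1) φ → SigmaSO (n + 1) (.ex x φ)
  /-- `Πₙ⁰` formulas of the second-order arithmetic hierarchy. -/
  inductive PiSO : ℕ → Fml → Prop
    | delta0 {n : ℕ} {φ : Fml} : Delta0SO φ → PiSO n φ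
    | ofSigma {n : ℕ} {φ : Fml} : SigmaSO n φ → PiSO (n + 1) φ
    | all (x : ℕ) {n : ℕ} {φ : Fml} : PiSO (n + 1) φ → PiSO (n + 1) (.all x φ)
end

/-! ## First-order theories -/

/-- `PA⁻`: the theory of non-negative parts of discretely ordered rings. -/
structure PAminus (S : Str) : Prop where
  add_assoc : ∀ a b c, S.add (S.add a b) c = S.add a (S.add b c)
  add_comm : ∀ a b, S.add a b = S.add b a
  mul_assoc : ∀ a b c, S.mul (S.mul a b) c = S.mul a (S.mul b c)
  mul_comm : ∀ a b, S.mul a b = S.mul b a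
  distrib : ∀ a b c, S.mul a (S.add b c) = S.add (S.mul a b) (S.mul a c)
  add_zero : ∀ a, S.add a S.zero = a
  mul_zero : ∀ a, S.mul a S.zero = S.zero
  mul_one : ∀ a, S.mul a S.one = a
  lt_irrefl : ∀ a, ¬ S.lt a a
  lt_trans : ∀ a b c, S.lt a b → S.lt b c → S.lt a c
  lt_total : ∀ a b, S.lt a b ∨ a = b ∨ S.lt b a
  add_lt_add : ∀ a b c, S.lt a b → S.lt (S.add a c) (S.add b c)
  mul_lt_mul : ∀ a b c, S.lt a b → S.lt S.zero c → S.lt (S.mul a c) (S.mul b c)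
  zero_lt_one : S.lt S.zero S.one
  zero_le : ∀ a, a = S.zero ∨ S.lt S.zero a
  discrete : ∀ a b, S.lt a b → S.add a S.one = b ∨ S.lt (S.add a S.one) b
  pred : ∀ a, S.lt S.zero a → ∃ b, S.add b S.one = a
  sub : ∀ a b, S.lt a b → ∃ c, S.add a c = b

/-- The induction scheme for the class `Γ` of formulas
(parameters are allowed via the ambient valuation `v`). -/
def IndFor (S : Str) (Γ : Fml → Prop) : Prop :=
  ∀ φ : Fml, Γ φ → ∀ (v : ℕ → S.M) (x : ℕ),
    Sat0 S (upd v x S.zero) φ →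
    (∀ m, Sat0 S (upd v x m) φ → Sat0 S (upd v x (S.add m S.one)) φ) →
    ∀ m, Sat0 S (upd v x m) φ

/-- The collection scheme for the class `Γ`:
`(∀ x < a ∃ y φ) → (∃ b ∀ x < a ∃ y < b φ)`. -/
def CollFor (S : Str) (Γ : Fml → Prop) : Prop :=
  ∀ φ : Fml, Γ φ → ∀ (v : ℕ → S.M) (x y : ℕ), x ≠ y → ∀ a : S.M,
    (∀ m, S.lt m a → ∃ k, Sat0 S (upd (upd v x m) y k) φ) →
    ∃ b, ∀ m, S.lt m a → ∃ k, S.lt k b ∧ Sat0 S (upd (upd v x m) y k) φ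

/-- `IΔ₀` (over `PA⁻`). -/
def IDelta0 (S : Str) : Prop := PAminus S ∧ IndFor S Delta0

/-- `IΣₙ` (over `PA⁻`; note `Δ₀ ⊆ Σₙ`, so this includes `IΔ₀`). -/
def ISigma (S : Str) (n : ℕ) : Prop := PAminus S ∧ IndFor S (IsSigma n)

/-- `BΣₙ`: the `Σₙ`-collection scheme, including `IΔ₀` (over `PA⁻`). -/
def BSigma (S : Str) (n : ℕ) : Prop := IDelta0 S ∧ CollFor S (IsSigma n)

/-- The weak regularity principle `WRφ` for all `φ` in the class `Γ`:
the universal closure of `(∀ x ∃ y < a φ(x,y)) → (∃ y < a ∀ b ∃ x > b φ(x,y))`.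
Here `x, y` are the two displayed variables and all other free variables of
`φ` are parameters, interpreted by the ambient valuation `v`. -/
def WRFor (S : Str) (Γ : Fml → Prop) : Prop :=
  ∀ φ : Fml, Γ φ → ∀ (v : ℕ → S.M) (x y : ℕ), x ≠ y → ∀ a : S.M,
    (∀ m, ∃ k, S.lt k a ∧ Sat0 S (upd (upd v x m) y k) φ) →
    ∃ k, S.lt k a ∧ ∀ b, ∃ m, S.lt b m ∧ Sat0 S (upd (upd v x m) y k) φ

/-! ## Second-order theories -/

/-- Second-order induction scheme for the class `Γ`, with set parameters
from the second-order universe `X`. -/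
def IndForSO (S : Str) (X : Set (Set S.M)) (Γ : Fml → Prop) : Prop :=
  ∀ φ : Fml, Γ φ → ∀ (v : ℕ → S.M) (w : ℕ → Set S.M), (∀ i, w i ∈ X) → ∀ x : ℕ,
    Sat S X (upd v x S.zero) w φ →
    (∀ m, Sat S X (upd v x m) w φ → Sat S X (upd v x (S.add m S.one)) w φ) →
    ∀ m, Sat S X (upd v x m) w φ

/-- Second-order collection scheme for the class `Γ`. -/
def CollForSO (S : Str) (X : Set (Set S.M)) (Γ : Fml → Prop) : Prop :=
  ∀ φ : Fml, Γ φ → ∀ (v : ℕ → S.M) (w : ℕ → Set S.M), (∀ i, w i ∈ X) →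
    ∀ (x y : ℕ), x ≠ y → ∀ a : S.M,
    (∀ m, S.lt m a → ∃ k, Sat S X (upd (upd v x m) y k) w φ) →
    ∃ b, ∀ m, S.lt m a → ∃ k, S.lt k b ∧ Sat S X (upd (upd v x m) y k) w φ

/-- `Δ₁⁰`-comprehension. -/
def Delta1CA (S : Str) (X : Set (Set S.M)) : Prop :=
  ∀ φ ψ : Fml, SigmaSO 1 φ → PiSO 1 ψ →
    ∀ (v : ℕ → S.M) (w : ℕ → Set S.M), (∀ i, w i ∈ X) → ∀ x : ℕ,
    (∀ m, Sat S X (upd v x m) w φ ↔ Sat S X (upd v x m) w ψ) →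
    ∃ A ∈ X, ∀ m, m ∈ A ↔ Sat S X (upd v x m) w φ

/-- `Σₙ`-comprehension for first-order formulas with parameters from `M`. -/
def SigmaCA (S : Str) (X : Set (Set S.M)) (n : ℕ) : Prop :=
  ∀ φ : Fml, IsSigma n φ → ∀ (v : ℕ → S.M) (x : ℕ),
    ∃ A ∈ X, ∀ m, m ∈ A ↔ Sat0 S (upd v x m) φ

/-- `RCA₀`. -/
def RCA0 (S : Str) (X : Set (Set S.M)) : Prop :=
  PAminus S ∧ IndForSO S X (SigmaSO 1) ∧ Delta1CA S X

/-- `Σ₁⁰`-separation; over `RCA₀` this is equivalent to weak Kőnig's lemma. -/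
def Sigma1Sep (S : Str) (X : Set (Set S.M)) : Prop :=
  ∀ φ ψ : Fml, SigmaSO 1 φ → SigmaSO 1 ψ →
    ∀ (v : ℕ → S.M) (w : ℕ → Set S.M), (∀ i, w i ∈ X) → ∀ x : ℕ,
    (∀ m, ¬ (Sat S X (upd v x m) w φ ∧ Sat S X (upd v x m) w ψ)) →
    ∃ A ∈ X, ∀ m, (Sat S X (upd v x m) w φ → m ∈ A) ∧ (m ∈ A → ¬ Sat S X (upd v x m) w ψ)

/-- `WKL₀`, rendered as `RCA₀` plus `Σ₁⁰`-separation (which is equivalent,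
over `RCA₀`, to weak Kőnig's lemma). -/
def WKL0 (S : Str) (X : Set (Set S.M)) : Prop := RCA0 S X ∧ Sigma1Sep S X

/-- `BΣₙ⁰`: the second-order `Σₙ⁰`-collection scheme (including `IΔ₀⁰`,
over `PA⁻`). -/
def BSigmaSO (S : Str) (X : Set (Set S.M)) (n : ℕ) : Prop :=
  PAminus S ∧ IndForSO S X Delta0SO ∧ CollForSO S X (SigmaSO n)

/-- `IΣₙ⁰`: the second-order `Σₙ⁰`-induction scheme, over `RCA₀`. -/
def ISigmaSO (S : Str) (X : Set (Set S.M)) (n : ℕ) : Prop :=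
  RCA0 S X ∧ IndForSO S X (SigmaSO n)

/-! ## Exponentiation and binary digits -/

/-- Satisfaction of a three-variable formula `E(x₀, x₁, x₂)` at `(a, b, c)`. -/
def ExpAt (S : Str) (E : Fml) (a b c : S.M) : Prop :=
  Sat0 S (fun i => if i = 0 then a else if i = 1 then b else c) E

/-- `E(x₀,x₁,x₂)` is a `Δ₀` definition of the (total) exponentiation function
`x₀ ^ x₁ = x₂`.  The existence of such an `E` expresses `exp`
(the totality of exponentiation). -/
structure IsExpDef (S : Str) (E : Fml) : Prop where
  delta0 : Delta0 E
  base : ∀ a, ExpAt S E a S.zero S.one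
  total : ∀ a b, ∃ c, ExpAt S E a b c
  unique : ∀ a b c c', ExpAt S E a b c → ExpAt S E a b c' → c = c'
  step : ∀ a b c, ExpAt S E a b c → ExpAt S E a (S.add b S.one) (S.mul c a)

/-- `exp`: the totality of exponentiation (via a `Δ₀` definition of its
graph). -/
def SatExp (S : Str) : Prop := ∃ E : Fml, IsExpDef S E

/-! ## Embeddings, end extensions and elementarity -/

/-- An embedding of arithmetic structures. -/
structure Emb (S K : Str) where
  j : S.M → K.M
  inj : Function.Injective j
  zero : j S.zero = K.zero
  one : j S.one = K.one
  add : ∀ a b, j (S.add a b) = K.add (j a) (j b)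
  mul : ∀ a b, j (S.mul a b) = K.mul (j a) (j b)
  lt_iff : ∀ a b, S.lt a b ↔ K.lt (j a) (j b)

/-- The extension along `e` is an end extension: every element of `K` not in
the image of `M` exceeds every element of `M`. -/
def IsEndExt {S K : Str} (e : Emb S K) : Prop :=
  ∀ b : K.M, b ∉ Set.range e.j → ∀ a : S.M, K.lt (e.j a) b

/-- The extension along `e` is proper. -/
def IsProper {S K : Str} (e : Emb S K) : Prop := ¬ Function.Surjective e.j

/-- The extension along `e` is `Σₙ`-elementary: all `Σₙ` formulas with
parameters from `M` are absolute between `M` and `K`. -/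
def SigmaElem {S K : Str} (e : Emb S K) (n : ℕ) : Prop :=
  ∀ φ : Fml, IsSigma n φ → ∀ v : ℕ → S.M,
    (Sat0 S v φ ↔ Sat0 K (fun i => e.j (v i)) φ)

/-- `K ⊨ M‑IΣₙ` (for an extension `e : M → K`): induction up to any `a ∈ M`
for `Σₙ` formulas with parameters from `K`. -/
def MISigma {S K : Str} (e : Emb S K) (n : ℕ) : Prop :=
  ∀ φ : Fml, IsSigma n φ → ∀ (v : ℕ → K.M) (x : ℕ) (a : S.M),
    Sat0 K (upd v x K.zero) φ →
    (∀ m, K.lt m (e.j a) → (Sat0 K (upd v x m) φ → Sat0 K (upd v x (K.add m K.one)) φ)) →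
    ∀ m, K.lt m (e.j a) → Sat0 K (upd v x m) φ

/-- The `x`-th binary digit of `c ∈ K` is `1`, computed via a `Δ₀` definition
`E` of exponentiation on the ground model `S` (here `x` lies under the image
of `S`): there are `x', p ∈ M` with `j x' = x`, `p = 2 ^ x'`, and `u, v ∈ K`
with `c = u·(2p) + p + v` and `v < p`. -/
def BitVia {S K : Str} (e : Emb S K) (E : Fml) (x c : K.M) : Prop :=
  ∃ x' p : S.M, e.j x' = x ∧ ExpAt S E (S.add S.one S.one) x' p ∧
    ∃ u v : K.M, K.lt v (e.j p) ∧
      c = K.add (K.add (K.mul u (K.add (e.j p) (e.j p))) (e.j p)) v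

/-! ## The second-order restricted ultrapower -/

/-- `A` is cofinal (unbounded) in `S`. -/
def Cofinal (S : Str) (A : Set S.M) : Prop := ∀ b : S.M, ∃ x ∈ A, S.lt b x

/-- The pairing term `⟨x, y⟩ = (x + y)·(x + y) + x`. -/
def pairS (S : Str) (x y : S.M) : S.M := S.add (S.mul (S.add x y) (S.add x y)) x

/-- The graph of `f : M → M`, coded as a subset of `M` via pairing. -/
def graphOf (S : Str) (f : S.M → S.M) : Set S.M := {m | ∃ x, m = pairS S x (f x)}

/-- `f` is a total function `M → M` lying in the second-order universe `X`
(its coded graph belongs to `X`).  The collection of such `f` is the class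
`ℱ` of the restricted ultrapower. -/
def FuncIn (S : Str) (X : Set (Set S.M)) (f : S.M → S.M) : Prop := graphOf S f ∈ X

/-- `U` is an ultrafilter on the Boolean algebra `X`, all of whose elements
are cofinal in `M`. -/
structure UltraOn (S : Str) (X U : Set (Set S.M)) : Prop where
  subset : U ⊆ X
  univ_mem : Set.univ ∈ U
  empty_not_mem : ∅ ∉ U
  inter_mem : ∀ A ∈ U, ∀ B ∈ U, A ∩ B ∈ U
  superset_mem : ∀ A ∈ U, ∀ B ∈ X, A ⊆ B → B ∈ U
  ultra : ∀ A ∈ X, A ∈ U ∨ Aᶜ ∈ U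
  cofinal : ∀ A ∈ U, Cofinal S A

/-- A realization of the second-order restricted ultrapower `ℱ/𝒰` of `S`
with respect to the second-order universe `X` and the ultrafilter `U`:
a structure `K` whose elements are exactly the classes `cls f hf = [f]` of
total functions `f ∈ ℱ`, where `[f] = [g]` iff `f = g` on a set in `U`, with
pointwise arithmetic operations, order decided by `U`, and the inherited
second-order membership relation `memK` serving as the second-order expansion. -/
structure RUP (S : Str) (X U : Set (Set S.M)) : Type 1 where
  K : Str
  cls : (f : S.M → S.M) → FuncIn S X f → K.M
  memK : K.M → Set S.M → Prop
  const_in : ∀ a : S.M, FuncIn S X (fun _ => a)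
  surj : ∀ b : K.M, ∃ (f : S.M → S.M) (hf : FuncIn S X f), cls f hf = b
  eq_iff : ∀ (f : S.M → S.M) (hf : FuncIn S X f) (g : S.M → S.M) (hg : FuncIn S X g),
      (cls f hf = cls g hg) ↔ {i : S.M | f i = g i} ∈ U
  lt_iff : ∀ (f : S.M → S.M) (hf : FuncIn S X f) (g : S.M → S.M) (hg : FuncIn S X g),
      K.lt (cls f hf) (cls g hg) ↔ {i : S.M | S.lt (f i) (g i)} ∈ U
  zero_eq : K.zero = cls (fun _ => S.zero) (const_in S.zero)
  one_eq : K.one = cls (fun _ => S.one) (const_in S.one)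
  add_eq : ∀ (f : S.M → S.M) (hf : FuncIn S X f) (g : S.M → S.M) (hg : FuncIn S X g)
      (h : S.M → S.M) (hh : FuncIn S X h), (∀ i, h i = S.add (f i) (g i)) →
      K.add (cls f hf) (cls g hg) = cls h hh
  mul_eq : ∀ (f : S.M → S.M) (hf : FuncIn S X f) (g : S.M → S.M) (hg : FuncIn S X g)
      (h : S.M → S.M) (hh : FuncIn S X h), (∀ i, h i = S.mul (f i) (g i)) →
      K.mul (cls f hf) (cls g hg) = cls h hh
  mem_iff : ∀ (f : S.M → S.M) (hf : FuncIn S X f) (A : Set S.M), A ∈ X →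
      (memK (cls f hf) A ↔ {i : S.M | f i ∈ A} ∈ U)

/-- The canonical embedding `M → ℱ/𝒰` via constant functions. -/
def RUP.emb {S : Str} {X U : Set (Set S.M)} (R : RUP S X U) (a : S.M) : R.K.M :=
  R.cls (fun _ => a) (R.const_in a)

/-- The subset of `ℱ/𝒰` induced by `A ⊆ M`. -/
def RUP.setImg {S : Str} {X U : Set (Set S.M)} (R : RUP S X U) (A : Set S.M) :
    Set R.K.M := {b | R.memK b A}

/-- The second-order part of the expanded ultrapower `(ℱ/𝒰, 𝒳)`:
the (injected) copy of `X`. -/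
def RUP.X2 {S : Str} {X U : Set (Set S.M)} (R : RUP S X U) : Set (Set R.K.M) :=
  (fun A => R.setImg A) '' X

end PaperArith

namespace PaperArith

/-! ## Valuations, variable support and bounded formulas -/

theorem upd_same {α : Type} (v : ℕ → α) (x : ℕ) (a : α) : upd v x a x = a := by simp [upd]

theorem upd_ne {α : Type} (v : ℕ → α) {x y : ℕ} (a : α) (h : y ≠ x) : upd v x a y = v y := by
  simp [upd, h]

theorem upd_upd {α : Type} (v : ℕ → α) (x : ℕ) (a b : α) :
    upd (upd v x a) x b = upd v x b := by
  funext k; simp only [upd]; split_ifs <;> rfl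

theorem upd_comm {α : Type} (v : ℕ → α) {x y : ℕ} (h : x ≠ y) (a b : α) :
    upd (upd v x a) y b = upd (upd v y b) x a := by
  funext k; simp only [upd]; split_ifs <;> simp_all

theorem upd_comp {α β : Type} (c : α → β) (v : ℕ → α) (x : ℕ) (a : α) :
    upd (fun k => c (v k)) x (c a) = fun k => c (upd v x a k) := by
  funext k; simp only [upd]; split_ifs <;> rfl

theorem tval_support (t : Term) : ∃ N, ∀ (S : Str) (v v' : ℕ → S.M),
    (∀ k < N, v k = v' k) → tval S v t = tval S v' t := by
  induction t with
  | var i => exact ⟨i + 1, fun S v v' h => h i (by omega)⟩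
  | zero => exact ⟨0, fun _ _ _ _ => rfl⟩
  | one => exact ⟨0, fun _ _ _ _ => rfl⟩
  | add t u iht ihu =>
    obtain ⟨a, ha⟩ := iht
    obtain ⟨b, hb⟩ := ihu
    refine ⟨max a b, fun S v v' h => ?_⟩
    simp only [tval]
    rw [ha S v v' fun k hk => h k (by omega), hb S v v' fun k hk => h k (by omega)]
  | mul t u iht ihu =>
    obtain ⟨a, ha⟩ := iht
    obtain ⟨b, hb⟩ := ihu
    refine ⟨max a b, fun S v v' h => ?_⟩
    simp only [tval]
    rw [ha S v v' fun k hk => h k (by omega), hb S v v' fun k hk => h k (by omega)]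

/-- Satisfaction of `φ` depends only on the variables of index below `N`. -/
def Supp (N : ℕ) (φ : Fml) : Prop :=
  ∀ (S : Str) (X : Set (Set S.M)) (v v' : ℕ → S.M) (w w' : ℕ → Set S.M),
    (∀ k < N, v k = v' k) → (∀ k < N, w k = w' k) → (Sat S X v w φ ↔ Sat S X v' w' φ)

theorem Supp.mono {N N' : ℕ} {φ : Fml} (h : Supp N φ) (hN : N ≤ N') : Supp N' φ :=
  fun S X v v' w w' hv hw =>
    h S X v v' w w' (fun k hk => hv k (by omega)) (fun k hk => hw k (by omega))

theorem upd_agree {α : Type} {N : ℕ} {v v' : ℕ → α} (h : ∀ k < N, v k = v' k) (x : ℕ) (m : α) :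
    ∀ k < N, upd v x m k = upd v' x m k := by
  intro k hk
  simp only [upd]
  split_ifs
  · rfl
  · exact h k hk

theorem Supp.not {N : ℕ} {φ : Fml} (h : Supp N φ) : Supp N (.not φ) :=
  fun S X v v' w w' hv hw => not_congr (h S X v v' w w' hv hw)

theorem Delta0SO.exists_supp {φ : Fml} (h : Delta0SO φ) : ∃ N, Supp N φ := by
  induction h with
  | eq t u =>
    obtain ⟨a, ha⟩ := tval_support t
    obtain ⟨b, hb⟩ := tval_support u
    refine ⟨max a b, fun S X v v' w w' h _ => ?_⟩
    simp only [Sat]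
    rw [ha S v v' fun k hk => h k (by omega), hb S v v' fun k hk => h k (by omega)]
  | lt t u =>
    obtain ⟨a, ha⟩ := tval_support t
    obtain ⟨b, hb⟩ := tval_support u
    refine ⟨max a b, fun S X v v' w w' h _ => ?_⟩
    simp only [Sat]
    rw [ha S v v' fun k hk => h k (by omega), hb S v v' fun k hk => h k (by omega)]
  | mem t i =>
    obtain ⟨a, ha⟩ := tval_support t
    refine ⟨max a (i + 1), fun S X v v' w w' h hw => ?_⟩
    simp only [Sat]
    rw [ha S v v' fun k hk => h k (by omega), hw i (by omega)]
  | not _ ih =>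
    obtain ⟨a, ha⟩ := ih
    exact ⟨a, ha.not⟩
  | and _ _ ih ih' =>
    obtain ⟨a, ha⟩ := ih
    obtain ⟨b, hb⟩ := ih'
    exact ⟨max a b, fun S X v v' w w' hv hw =>
      and_congr (ha.mono (le_max_left _ _) S X v v' w w' hv hw)
        (hb.mono (le_max_right _ _) S X v v' w w' hv hw)⟩
  | or _ _ ih ih' =>
    obtain ⟨a, ha⟩ := ih
    obtain ⟨b, hb⟩ := ih'
    exact ⟨max a b, fun S X v v' w w' hv hw =>
      or_congr (ha.mono (le_max_left _ _) S X v v' w w' hv hw)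
        (hb.mono (le_max_right _ _) S X v v' w w' hv hw)⟩
  | imp _ _ ih ih' =>
    obtain ⟨a, ha⟩ := ih
    obtain ⟨b, hb⟩ := ih'
    exact ⟨max a b, fun S X v v' w w' hv hw =>
      imp_congr (ha.mono (le_max_left _ _) S X v v' w w' hv hw)
        (hb.mono (le_max_right _ _) S X v v' w w' hv hw)⟩
  | ball x t _ ih =>
    obtain ⟨a, ha⟩ := tval_support t
    obtain ⟨b, hb⟩ := ih
    refine ⟨max a b, fun S X v v' w w' hv hw => ?_⟩
    simp only [Sat]
    rw [ha S v v' fun k hk => hv k (by omega)]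
    exact forall_congr' fun m => imp_congr Iff.rfl
      (hb.mono (le_max_right _ _) S X _ _ w w' (upd_agree hv x m) hw)
  | bex x t _ ih =>
    obtain ⟨a, ha⟩ := tval_support t
    obtain ⟨b, hb⟩ := ih
    refine ⟨max a b, fun S X v v' w w' hv hw => ?_⟩
    simp only [Sat]
    rw [ha S v v' fun k hk => hv k (by omega)]
    exact exists_congr fun m => and_congr Iff.rfl
      (hb.mono (le_max_right _ _) S X _ _ w w' (upd_agree hv x m) hw)

/-- The conjunction of `ψ 0, …, ψ (n - 1)`. -/
def conj (ψ : ℕ → Fml) : ℕ → Fml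
  | 0 => .eq .zero .zero
  | n + 1 => .and (conj ψ n) (ψ n)

theorem delta0SO_conj {ψ : ℕ → Fml} (h : ∀ k, Delta0SO (ψ k)) (n : ℕ) :
    Delta0SO (conj ψ n) := by
  induction n with
  | zero => exact .eq _ _
  | succ n ih => exact .and ih (h n)

theorem sat_conj {S : Str} {X : Set (Set S.M)} {v : ℕ → S.M} {w : ℕ → Set S.M} {ψ : ℕ → Fml}
    (n : ℕ) : Sat S X v w (conj ψ n) ↔ ∀ k < n, Sat S X v w (ψ k) := by
  induction n with
  | zero => simp [conj, Sat]
  | succ n ih =>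
    simp only [conj, Sat, ih]
    exact Nat.forall_lt_succ_right.symm

/-- Existential quantification over all variables of index below `n` except `q`. -/
def exBlock (q : ℕ) (φ : Fml) : ℕ → Fml
  | 0 => φ
  | n + 1 => if n = q then exBlock q φ n else .ex n (exBlock q φ n)

/-- Universal quantification over all variables of index below `n` except `q`. -/
def allBlock (q : ℕ) (φ : Fml) : ℕ → Fml
  | 0 => φ
  | n + 1 => if n = q then allBlock q φ n else .all n (allBlock q φ n)

theorem sigmaSO_exBlock (q : ℕ) {φ : Fml} (h : Delta0SO φ) (n : ℕ) :
    SigmaSO 1 (exBlock q φ n) := by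
  induction n with
  | zero => exact .delta0 h
  | succ n ih =>
    simp only [exBlock]
    split_ifs
    · exact ih
    · exact .ex _ ih

theorem piSO_allBlock (q : ℕ) {φ : Fml} (h : Delta0SO φ) (n : ℕ) :
    PiSO 1 (allBlock q φ n) := by
  induction n with
  | zero => exact .delta0 h
  | succ n ih =>
    simp only [allBlock]
    split_ifs
    · exact ih
    · exact .all _ ih

theorem sat_exBlock {S : Str} {X : Set (Set S.M)} {w : ℕ → Set S.M} (q : ℕ) (φ : Fml) (n : ℕ)
    (v : ℕ → S.M) : Sat S X v w (exBlock q φ n) ↔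
      ∃ v' : ℕ → S.M, v' q = v q ∧ (∀ k, n ≤ k → v' k = v k) ∧ Sat S X v' w φ := by
  induction n generalizing v with
  | zero =>
    refine ⟨fun h => ⟨v, rfl, fun _ _ => rfl, h⟩, ?_⟩
    rintro ⟨v', -, h, h'⟩
    rwa [funext fun k => h k (Nat.zero_le k)] at h'
  | succ n ih =>
    simp only [exBlock]
    split_ifs with hn
    · rw [ih]
      constructor
      · rintro ⟨v', h1, h2, h3⟩
        exact ⟨v', h1, fun k hk => h2 k (by omega), h3⟩
      · rintro ⟨v', h1, h2, h3⟩
        refine ⟨v', h1, fun k hk => ?_, h3⟩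
        by_cases hk' : k = q
        · rw [hk', h1]
        · exact h2 k (by omega)
    · simp only [Sat, ih]
      constructor
      · rintro ⟨m, v', h1, h2, h3⟩
        refine ⟨v', by rw [h1, upd_ne _ _ (Ne.symm hn)], fun k hk => ?_, h3⟩
        rw [h2 k (by omega), upd_ne _ _ (by omega)]
      · rintro ⟨v', h1, h2, h3⟩
        refine ⟨v' n, v', by rw [h1, upd_ne _ _ (Ne.symm hn)], fun k hk => ?_, h3⟩
        by_cases hk' : k = n
        · rw [hk', upd_same]
        · rw [upd_ne _ _ hk', h2 k (by omega)]

theorem sat_allBlock_not {S : Str} {X : Set (Set S.M)} {w : ℕ → Set S.M} (q : ℕ) (φ : Fml)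
    (n : ℕ) (v : ℕ → S.M) :
    Sat S X v w (allBlock q (.not φ) n) ↔ ¬ Sat S X v w (exBlock q φ n) := by
  induction n generalizing v with
  | zero => rfl
  | succ n ih =>
    simp only [allBlock, exBlock]
    split_ifs
    · exact ih v
    · simp only [Sat, ih, not_exists]

/-! ## Order and pairing in models of `PA⁻` -/

/-- The commutative semiring underlying a model of `PA⁻`. -/
abbrev PAminus.commSemiring {S : Str} (h : PAminus S) : CommSemiring S.M where
  add := S.add
  zero := S.zero
  mul := S.mul
  one := S.one
  add_assoc := h.add_assoc
  add_comm := h.add_comm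
  zero_add a := (h.add_comm _ _).trans (h.add_zero a)
  add_zero := h.add_zero
  mul_assoc := h.mul_assoc
  mul_comm := h.mul_comm
  one_mul a := (h.mul_comm _ _).trans (h.mul_one a)
  mul_one := h.mul_one
  zero_mul a := (h.mul_comm _ _).trans (h.mul_zero a)
  mul_zero := h.mul_zero
  left_distrib := h.distrib
  right_distrib a b c := by
    change S.mul (S.add a b) c = S.add (S.mul a c) (S.mul b c)
    rw [h.mul_comm, h.distrib, h.mul_comm c a, h.mul_comm c b]
  nsmul := @nsmulRec _ ⟨S.zero⟩ ⟨S.add⟩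

/-- The linear order underlying a model of `PA⁻`. -/
noncomputable abbrev PAminus.linearOrder {S : Str} (h : PAminus S) : LinearOrder S.M where
  le a b := a = b ∨ S.lt a b
  lt := S.lt
  le_refl _ := .inl rfl
  le_trans a b c := by
    rintro (rfl | h1) (rfl | h2)
    exacts [.inl rfl, .inr h2, .inr h1, .inr (h.lt_trans _ _ _ h1 h2)]
  lt_iff_le_not_ge a b := by
    constructor
    · refine fun hab => ⟨.inr hab, ?_⟩
      rintro (rfl | hba)
      exacts [h.lt_irrefl _ hab, h.lt_irrefl _ (h.lt_trans _ _ _ hab hba)]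
    · rintro ⟨rfl | hab, h2⟩
      exacts [(h2 (.inl rfl)).elim, hab]
  le_antisymm a b := by
    rintro (rfl | h1) (h2 | h2)
    exacts [rfl, rfl, h2.symm, (h.lt_irrefl _ (h.lt_trans _ _ _ h1 h2)).elim]
  le_total a b := by
    rcases h.lt_total a b with h1 | h1 | h1
    exacts [.inl (.inr h1), .inl (.inl h1), .inr (.inr h1)]
  toDecidableLE := Classical.decRel _

section

variable {S : Str} (h : PAminus S)
include h

theorem PAminus.isStrictOrderedRing :
    letI := h.commSemiring
    letI := h.linearOrder
    IsStrictOrderedRing S.M := by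
  let _ := h.commSemiring
  let _ := h.linearOrder
  have hadd : ∀ a b c : S.M, a < b → a + c < b + c := h.add_lt_add
  have hadd' : ∀ a b : S.M, a ≤ b → ∀ c, a + c ≤ b + c := by
    rintro a b (rfl | hab) c
    exacts [le_rfl, (hadd a b c hab).le]
  have hcancel : ∀ a b c : S.M, b + a ≤ c + a → b ≤ c := fun a b c hbc =>
    not_lt.1 fun hcb => (hadd _ _ a hcb).not_ge hbc
  have hmul : ∀ a b c : S.M, a < b → 0 < c → a * c < b * c := h.mul_lt_mul
  exact
    { add_le_add_left := hadd'
      le_of_add_le_add_left := fun a b c hbc =>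
        hcancel a b c (by rwa [_root_.add_comm b, _root_.add_comm c])
      zero_le_one := (show (0 : S.M) < 1 from h.zero_lt_one).le
      exists_pair_ne := ⟨0, 1, (show (0 : S.M) < 1 from h.zero_lt_one).ne⟩
      mul_lt_mul_of_pos_left := fun a ha b c hbc => by
        simpa only [_root_.mul_comm a] using hmul b c a hbc ha
      mul_lt_mul_of_pos_right := fun a ha b c hbc => hmul b c a hbc ha }

theorem PAminus.nonneg (a : S.M) : h.linearOrder.le S.zero a := by
  rcases h.zero_le a with rfl | ha
  exacts [.inl rfl, .inr ha]

theorem PAminus.not_lt_zero (a : S.M) : ¬ S.lt a S.zero := by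
  intro ha
  rcases h.zero_le a with rfl | h'
  · exact h.lt_irrefl _ ha
  · exact h.lt_irrefl _ (h.lt_trans _ _ _ ha h')

theorem PAminus.lt_succ_iff (a b : S.M) : S.lt a (S.add b S.one) ↔ S.lt a b ∨ a = b := by
  have hb : S.lt b (S.add b S.one) := by
    have := h.add_lt_add _ _ b h.zero_lt_one
    rwa [h.add_comm, h.add_zero, h.add_comm] at this
  constructor
  · intro hab
    rcases h.lt_total a b with h1 | h1 | h1
    · exact .inl h1
    · exact .inr h1
    · rcases h.discrete _ _ h1 with rfl | h2
      · exact (h.lt_irrefl _ hab).elim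
      · exact (h.lt_irrefl _ (h.lt_trans _ _ _ hab h2)).elim
  · rintro (h1 | rfl)
    exacts [h.lt_trans _ _ _ h1 hb, hb]

theorem PAminus.pairS_lt {x y x' y' : S.M} (hlt : S.lt (S.add x y) (S.add x' y')) :
    S.lt (pairS S x y) (pairS S x' y') := by
  let _ := h.commSemiring
  let _ := h.linearOrder
  have := h.isStrictOrderedRing
  have h1 : x + y + 1 ≤ x' + y' := h.discrete _ _ hlt
  have hx : x ≤ x + y := le_add_of_nonneg_right (h.nonneg y)
  change (x + y) * (x + y) + x < (x' + y') * (x' + y') + x'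
  calc (x + y) * (x + y) + x ≤ (x + y) * (x + y) + (x + y) := by gcongr
    _ < (x + y) * (x + y) + (x + y) + (x + y + 1) :=
        lt_add_of_pos_right _ (add_pos_of_nonneg_of_pos (h.nonneg (x + y)) h.zero_lt_one)
    _ = (x + y + 1) * (x + y + 1) := by ring
    _ ≤ (x' + y') * (x' + y') :=
        mul_le_mul h1 h1 (h.nonneg _) (h.nonneg _)
    _ ≤ (x' + y') * (x' + y') + x' := le_add_of_nonneg_right (h.nonneg x')

theorem PAminus.pairS_inj {x y x' y' : S.M} (he : pairS S x y = pairS S x' y') :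
    x = x' ∧ y = y' := by
  let _ := h.commSemiring
  let _ := h.linearOrder
  have := h.isStrictOrderedRing
  have hs : x + y = x' + y' := by
    rcases lt_trichotomy (x + y) (x' + y') with h1 | h1 | h1
    · exact (h.lt_irrefl _ (he ▸ h.pairS_lt h1)).elim
    · exact h1
    · exact (h.lt_irrefl _ (he ▸ h.pairS_lt h1)).elim
  have he' : (x + y) * (x + y) + x = (x' + y') * (x' + y') + x' := he
  rw [hs] at he'
  obtain rfl := add_left_cancel he'
  exact ⟨rfl, add_left_cancel hs⟩

theorem PAminus.lt_pairS_succ (x y : S.M) :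
    S.lt x (S.add (pairS S x y) S.one) ∧ S.lt y (S.add (pairS S x y) S.one) := by
  let _ := h.commSemiring
  let _ := h.linearOrder
  have := h.isStrictOrderedRing
  have hsq : x + y ≤ (x + y) * (x + y) := by
    rcases h.zero_le (x + y) with h0 | h0
    · rw [show x + y = 0 from h0]; simp
    · refine le_mul_of_one_le_left (h.nonneg _) ?_
      have : (0 : S.M) + 1 ≤ x + y := h.discrete _ _ h0
      rwa [zero_add] at this
  have hle : x + y ≤ (x + y) * (x + y) + x :=
    hsq.trans (le_add_of_nonneg_right (h.nonneg x))
  constructor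
  · rw [h.lt_succ_iff]
    exact lt_or_eq_of_le ((le_add_of_nonneg_right (h.nonneg y)).trans hle)
  · rw [h.lt_succ_iff]
    exact lt_or_eq_of_le ((le_add_of_nonneg_left (h.nonneg x)).trans hle)

theorem PAminus.pairS_mem_graphOf {f : S.M → S.M} {x y : S.M} :
    pairS S x y ∈ graphOf S f ↔ y = f x := by
  constructor
  · rintro ⟨x', hx'⟩
    obtain ⟨rfl, rfl⟩ := h.pairS_inj hx'
    rfl
  · rintro rfl
    exact ⟨x, rfl⟩

end

/-! ## Comprehension and choice of functions in models of `RCA₀` -/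

/-- The syntactic pairing term. -/
def pairT (t u : Term) : Term := .add (.mul (.add t u) (.add t u)) t

theorem tval_pairT (S : Str) (v : ℕ → S.M) (t u : Term) :
    tval S v (pairT t u) = pairS S (tval S v t) (tval S v u) := rfl

/-- The class `ℱ` of total functions in `X`. -/
abbrev Func (S : Str) (X : Set (Set S.M)) : Type := {f : S.M → S.M // FuncIn S X f}

section

variable {S : Str} {X : Set (Set S.M)}

theorem Delta1CA.mem_of_exists (hCA : Delta1CA S X) {w : ℕ → Set S.M} (hw : ∀ i, w i ∈ X)
    {A : Set S.M} (q : ℕ) {θ θ' : Fml} (hθ : Delta0SO θ) (hθ' : Delta0SO θ')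
    (hA : ∀ p, p ∈ A ↔ ∃ v : ℕ → S.M, v q = p ∧ Sat S X v w θ)
    (hA' : ∀ p, p ∉ A ↔ ∃ v : ℕ → S.M, v q = p ∧ Sat S X v w θ') : A ∈ X := by
  have key : ∀ χ : Fml, Delta0SO χ → ∃ N, ∀ n, N ≤ n → ∀ p,
      (Sat S X (upd (fun _ => S.zero) q p) w (exBlock q χ n) ↔
        ∃ v : ℕ → S.M, v q = p ∧ Sat S X v w χ) := by
    intro χ hχ
    obtain ⟨N, hN⟩ := hχ.exists_supp
    refine ⟨N, fun n hn p => ?_⟩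
    rw [sat_exBlock]
    constructor
    · rintro ⟨v, h1, -, h3⟩
      exact ⟨v, by rw [h1, upd_same], h3⟩
    · rintro ⟨v, h1, h2⟩
      refine ⟨fun k => if k = q then p else if k < n then v k else S.zero, by simp [upd_same],
        fun k hk => ?_, ?_⟩
      · simp [upd, Nat.not_lt.mpr hk]
      · refine (hN S X v _ w w (fun k hk => ?_) fun _ _ => rfl).1 h2
        by_cases hkq : k = q
        · simp [hkq, h1]
        · simp [hkq, show k < n by omega]
  obtain ⟨N, hN⟩ := key θ hθ
  obtain ⟨N', hN'⟩ := key θ' hθ'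
  obtain ⟨B, hB, hBA⟩ := hCA (exBlock q θ N) (allBlock q (.not θ') N')
    (sigmaSO_exBlock q hθ N) (piSO_allBlock q hθ'.not N') (fun _ => S.zero) w hw q fun p => by
      rw [sat_allBlock_not, hN N le_rfl, hN' N' le_rfl, ← hA, ← hA', not_not]
  have : B = A := Set.ext fun p => by rw [hBA, hN N le_rfl, hA]
  exact this ▸ hB

/-- The sets `w k` for `k < N`, followed by the graphs of the functions `f`. -/
def graphParams (w : ℕ → Set S.M) (f : ℕ → Func S X) (N k : ℕ) : Set S.M :=
  if k < N then w k else graphOf S (f (k - N)).1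

theorem graphParams_lt (w : ℕ → Set S.M) (f : ℕ → Func S X) {N k : ℕ} (h : k < N) :
    graphParams w f N k = w k := if_pos h

theorem graphParams_add (w : ℕ → Set S.M) (f : ℕ → Func S X) (N k : ℕ) :
    graphParams w f N (N + k) = graphOf S (f k).1 := by
  simp [graphParams]

theorem graphParams_mem {w : ℕ → Set S.M} (hw : ∀ k, w k ∈ X) (f : ℕ → Func S X) (N k : ℕ) :
    graphParams w f N k ∈ X := by
  unfold graphParams
  split_ifs
  exacts [hw k, (f _).2]

/-- `χ` holds of values of the functions `f` at the variable of index `N`. -/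
def evalFml (N : ℕ) (χ : Fml) : Fml :=
  .and (conj (fun k => .mem (pairT (.var N) (.var k)) (N + k)) N) χ

theorem delta0SO_evalFml (N : ℕ) {χ : Fml} (h : Delta0SO χ) : Delta0SO (evalFml N χ) :=
  .and (delta0SO_conj (fun _ => .mem _ _) _) h

theorem exists_sat_evalFml (hPA : PAminus S) (w : ℕ → Set S.M) (f : ℕ → Func S X) {N : ℕ}
    {χ : Fml} (hN : Supp N χ) (p : S.M) :
    (∃ v : ℕ → S.M, v N = p ∧ Sat S X v (graphParams w f N) (evalFml N χ)) ↔
      Sat S X (fun k => (f k).1 p) w χ := by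
  simp only [evalFml, Sat, sat_conj, tval_pairT, graphParams_add, hPA.pairS_mem_graphOf, tval]
  constructor
  · rintro ⟨v, rfl, h1, h2⟩
    exact (hN S X _ _ _ _ h1 fun k hk => graphParams_lt w f hk).1 h2
  · intro h
    have hv : ∀ k < N, (if k = N then p else (f k).1 p) = (f k).1 p :=
      fun k hk => if_neg (by omega)
    refine ⟨fun k => if k = N then p else (f k).1 p, by simp, fun k hk => ?_, ?_⟩
    · simpa using hv k hk
    · exact (hN S X _ _ _ _ hv fun k hk => graphParams_lt w f hk).2 h

theorem RCA0.setOf_sat_mem (hRCA : RCA0 S X) {φ : Fml} (hφ : Delta0SO φ) {w : ℕ → Set S.M}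
    (hw : ∀ k, w k ∈ X) (f : ℕ → Func S X) :
    {i | Sat S X (fun k => (f k).1 i) w φ} ∈ X := by
  obtain ⟨N, hN⟩ := hφ.exists_supp
  exact hRCA.2.2.mem_of_exists (graphParams_mem hw f N) N (delta0SO_evalFml N hφ)
    (delta0SO_evalFml N hφ.not) (fun p => (exists_sat_evalFml hRCA.1 w f hN p).symm)
    fun p => (exists_sat_evalFml hRCA.1 w f hN.not p).symm

/-- The variable `z` takes the least value satisfying `θ`. -/
def leastFml (z : ℕ) (θ : Fml) : Fml := .and θ (.ball z (.var z) (.not θ))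

theorem sat_leastFml {v : ℕ → S.M} {w : ℕ → Set S.M} {z : ℕ} {θ : Fml} {b : S.M} :
    Sat S X (upd v z b) w (leastFml z θ) ↔
      Sat S X (upd v z b) w θ ∧ ∀ m, S.lt m b → ¬ Sat S X (upd v z m) w θ := by
  simp only [leastFml, Sat, tval, upd_same, upd_upd]

theorem RCA0.existsUnique_least (hRCA : RCA0 S X) {θ : Fml} (hθ : Delta0SO θ) (v : ℕ → S.M)
    {w : ℕ → Set S.M} (hw : ∀ k, w k ∈ X) (z : ℕ) (hex : ∃ b, Sat S X (upd v z b) w θ) :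
    ∃! b, Sat S X (upd v z b) w (leastFml z θ) := by
  simp only [sat_leastFml]
  refine existsUnique_of_exists_of_unique ?_ ?_
  · by_contra! hn
    have hind := hRCA.2.1 (.ball z (.var z) (.not θ)) (.delta0 (.ball _ _ hθ.not)) v w hw z
    simp only [Sat, tval, upd_same, upd_upd] at hind
    obtain ⟨b, hb⟩ := hex
    refine hind (fun m hm => (hRCA.1.not_lt_zero m hm).elim) (fun m ih m' hm' => ?_)
      (S.add b S.one) b ((hRCA.1.lt_succ_iff _ _).2 (.inr rfl)) hb
    rcases (hRCA.1.lt_succ_iff _ _).1 hm' with h | rfl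
    · exact ih m' h
    · intro hs
      obtain ⟨k, hk, hk'⟩ := hn m' hs
      exact ih k hk hk'
  · rintro a b ⟨ha, ha'⟩ ⟨hb, hb'⟩
    rcases hRCA.1.lt_total a b with h | h | h
    exacts [(hb' a h ha).elim, h, (ha' b h hb).elim]

/-- The variable of index `N + 1` codes a pair whose second component, assigned to `z`,
satisfies `χ` together with the values of the functions `f` at the first component. -/
def graphFml (N z : ℕ) (χ : Fml) : Fml :=
  .and (.eq (.var (N + 1)) (pairT (.var N) (.var z)))
    (.and (conj (fun k => .or (if k = z then .eq .zero .zero else .lt .zero .zero)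
      (.mem (pairT (.var N) (.var k)) (N + k))) N) χ)

theorem delta0SO_graphFml (N z : ℕ) {χ : Fml} (h : Delta0SO χ) : Delta0SO (graphFml N z χ) := by
  refine .and (.eq _ _) (.and (delta0SO_conj (fun k => .or ?_ (.mem _ _)) _) h)
  split_ifs
  exacts [.eq _ _, .lt _ _]

theorem exists_sat_graphFml (hPA : PAminus S) (w : ℕ → Set S.M) (f : ℕ → Func S X) {N z : ℕ}
    (hz : z < N) {χ : Fml} (hN : Supp N χ) (p : S.M) :
    (∃ v : ℕ → S.M, v (N + 1) = p ∧ Sat S X v (graphParams w f N) (graphFml N z χ)) ↔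
      ∃ i m, p = pairS S i m ∧ Sat S X (upd (fun k => (f k).1 i) z m) w χ := by
  have hif : ∀ (v : ℕ → S.M) (w : ℕ → Set S.M) (k : ℕ),
      Sat S X v w (if k = z then .eq .zero .zero else .lt .zero .zero) ↔ k = z := by
    intro v w k
    split_ifs with hk <;> simp [Sat, hk, hPA.lt_irrefl]
  simp only [graphFml, Sat, sat_conj, tval_pairT, graphParams_add, hPA.pairS_mem_graphOf, tval,
    hif]
  constructor
  · rintro ⟨v, rfl, h1, h2, h3⟩
    refine ⟨v N, v z, h1, (hN S X _ _ _ _ (fun k hk => ?_) fun k hk => graphParams_lt w f hk).1 h3⟩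
    rcases h2 k hk with rfl | h
    · rw [upd_same]
    · simp only [upd]
      split_ifs with hk
      · rw [hk]
      · exact h
  · rintro ⟨i, m, hp, h⟩
    have hv : ∀ k < N, (if k = N + 1 then p else if k = N then i else
        upd (fun k => (f k).1 i) z m k) = upd (fun k => (f k).1 i) z m k :=
      fun k hk => by rw [if_neg (by omega), if_neg (by omega)]
    refine ⟨fun k => if k = N + 1 then p else if k = N then i else
        upd (fun k => (f k).1 i) z m k, by simp, ?_, fun k hk => ?_, ?_⟩
    · simpa [show z ≠ N + 1 by omega, hz.ne, upd_same] using hp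
    · simp only [hv k hk]
      by_cases hkz : k = z
      · exact .inl hkz
      · right
        rw [upd_ne _ _ hkz]
        simp
    · exact (hN S X _ _ _ _ hv fun k hk => graphParams_lt w f hk).2 h

/-- The variable of index `N + 1` does not code a pair. -/
def notPairFml (N z : ℕ) : Fml :=
  .ball N (.add (.var (N + 1)) .one) (.ball z (.add (.var (N + 1)) .one)
    (.not (.eq (.var (N + 1)) (pairT (.var N) (.var z)))))

theorem sat_notPairFml (hPA : PAminus S) (v : ℕ → S.M) (w : ℕ → Set S.M) {N z : ℕ} (hz : z < N) :
    Sat S X v w (notPairFml N z) ↔ ∀ i m, v (N + 1) ≠ pairS S i m := by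
  have h1 : N + 1 ≠ z := by omega
  have h2 : N ≠ z := by omega
  simp only [notPairFml, Sat, tval, tval_pairT, upd_same, upd_ne _ _ h1, upd_ne _ _ h2,
    upd_ne _ _ (Nat.succ_ne_self N)]
  constructor
  · intro h i m he
    have := hPA.lt_pairS_succ i m
    rw [← he] at this
    exact h i this.1 m this.2 he
  · exact fun h i _ m _ => h i m

/-- A total relation given by a bounded formula is uniformized by a function in `X`. -/
theorem RCA0.exists_func (hRCA : RCA0 S X) {θ : Fml} (hθ : Delta0SO θ) {w : ℕ → Set S.M}
    (hw : ∀ k, w k ∈ X) (f : ℕ → Func S X) (z : ℕ)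
    (hex : ∀ i, ∃ b, Sat S X (upd (fun k => (f k).1 i) z b) w θ) :
    ∃ g : Func S X, ∀ i, Sat S X (upd (fun k => (f k).1 i) z (g.1 i)) w θ := by
  choose g hg hg' using fun i => hRCA.existsUnique_least hθ (fun k => (f k).1 i) hw z (hex i)
  simp only at hg hg'
  refine ⟨⟨g, ?_⟩, fun i => (sat_leastFml.1 (hg i)).1⟩
  have hQ : Delta0SO (leastFml z θ) := .and hθ (.ball _ _ hθ.not)
  obtain ⟨N₀, hN₀⟩ := hQ.exists_supp
  obtain ⟨N, hN, hz⟩ : ∃ N, Supp N (leastFml z θ) ∧ z < N :=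
    ⟨max N₀ (z + 1), hN₀.mono (le_max_left _ _), by omega⟩
  have hgraph : ∀ p, p ∈ graphOf S g ↔
      ∃ i m, p = pairS S i m ∧ Sat S X (upd (fun k => (f k).1 i) z m) w (leastFml z θ) := by
    intro p
    constructor
    · rintro ⟨i, rfl⟩
      exact ⟨i, g i, rfl, hg i⟩
    · rintro ⟨i, m, rfl, hm⟩
      exact ⟨i, by rw [hg' i m hm]⟩
  refine hRCA.2.2.mem_of_exists (graphParams_mem hw f N) (N + 1) (delta0SO_graphFml N z hQ)
    (θ' := .or (notPairFml N z) (graphFml N z (.not (leastFml z θ))))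
    (.or (.ball _ _ (.ball _ _ (.not (.eq _ _)))) (delta0SO_graphFml N z hQ.not))
    (fun p => by rw [hgraph, exists_sat_graphFml hRCA.1 w f hz hN]) fun p => ?_
  have hor : (∃ v : ℕ → S.M, v (N + 1) = p ∧ Sat S X v (graphParams w f N)
        (.or (notPairFml N z) (graphFml N z (.not (leastFml z θ))))) ↔
      (∀ i m, p ≠ pairS S i m) ∨
        ∃ i m, p = pairS S i m ∧ Sat S X (upd (fun k => (f k).1 i) z m) w
          (.not (leastFml z θ)) := by
    rw [← exists_sat_graphFml hRCA.1 w f hz hN.not]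
    constructor
    · rintro ⟨v, rfl, h | h⟩
      · exact .inl ((sat_notPairFml hRCA.1 _ _ hz).1 h)
      · exact .inr ⟨v, rfl, h⟩
    · rintro (h | ⟨v, hv, h⟩)
      · exact ⟨fun _ => p, rfl, .inl ((sat_notPairFml hRCA.1 _ _ hz).2 h)⟩
      · exact ⟨v, hv, .inr h⟩
  rw [hor]
  constructor
  · intro hp
    by_cases hpair : ∃ i m, p = pairS S i m
    · obtain ⟨i, m, rfl⟩ := hpair
      exact .inr ⟨i, m, rfl, fun hm => hp ((hgraph _).2 ⟨i, m, rfl, hm⟩)⟩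
    · exact .inl fun i m he => hpair ⟨i, m, he⟩
  · rintro (h | ⟨i, m, rfl, hm⟩) ⟨j, hj⟩
    · exact h j _ hj
    · obtain ⟨rfl, rfl⟩ := hRCA.1.pairS_inj hj
      exact hm (hg i)

theorem RCA0.funcIn_tval (hRCA : RCA0 S X) (hne : X.Nonempty) (f : ℕ → Func S X) (t : Term) :
    FuncIn S X fun i => tval S (fun k => (f k).1 i) t := by
  obtain ⟨A, hA⟩ := hne
  obtain ⟨N, hN⟩ := tval_support t
  have ht : ∀ v b, tval S (upd v N b) t = tval S v t :=
    fun v b => hN S _ _ fun k hk => upd_ne _ _ (by omega)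
  obtain ⟨g, hg⟩ := hRCA.exists_func (.eq (.var N) t) (fun _ => hA) f N
    (w := fun _ => A) fun i => by simp only [Sat, tval, upd_same, ht, exists_eq]
  simp only [Sat, tval, upd_same, ht] at hg
  exact funext hg ▸ g.2

theorem RCA0.exists_func_bex (hRCA : RCA0 S X) {φ : Fml} (hφ : Delta0SO φ) {w : ℕ → Set S.M}
    (hw : ∀ k, w k ∈ X) (f : ℕ → Func S X) (x : ℕ) (t : Term) :
    ∃ g : Func S X, ∀ i, Sat S X (fun k => (f k).1 i) w (.bex x t φ) →
      S.lt (g.1 i) (tval S (fun k => (f k).1 i) t) ∧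
        Sat S X (upd (fun k => (f k).1 i) x (g.1 i)) w φ := by
  obtain ⟨N, hN⟩ := hφ.exists_supp
  obtain ⟨y, hyN, hxy⟩ : ∃ y, N ≤ y ∧ x < y := ⟨max N (x + 1), by omega, by omega⟩
  let h : Func S X := ⟨_, hRCA.funcIn_tval ⟨_, hw 0⟩ f t⟩
  let ψ : Fml := .and (.lt (.var x) (.var y)) φ
  have hψ : Delta0SO ψ := .and (.lt _ _) hφ
  have hsat : ∀ i b, Sat S X (upd (fun k => (upd f y h k).1 i) x b) w ψ ↔
      S.lt b (tval S (fun k => (f k).1 i) t) ∧ Sat S X (upd (fun k => (f k).1 i) x b) w φ := by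
    intro i b
    rw [← upd_comp (fun g : Func S X => g.1 i)]
    refine and_congr ?_ (hN S X _ _ _ _ (fun k hk => ?_) fun _ _ => rfl)
    · simp only [Sat, tval, upd_same, upd_ne _ _ (Nat.ne_of_gt hxy)]
      rfl
    · exact upd_agree (N := N) (fun j hj => upd_ne _ _ (by omega)) x b k hk
  obtain ⟨g, hg⟩ := hRCA.exists_func (θ := .or ψ (.ball x (.var y) (.not ψ)))
    (.or hψ (.ball _ _ hψ.not)) hw (upd f y h) x fun i => by
      simp only [Sat, tval, upd_upd]
      by_cases hb : ∃ b, Sat S X (upd (fun k => (upd f y h k).1 i) x b) w ψ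
      · exact hb.imp fun b hb => .inl hb
      · exact ⟨S.zero, .inr fun m _ hm => hb ⟨m, hm⟩⟩
  refine ⟨g, fun i hi => ?_⟩
  rcases hg i with h1 | h1
  · exact (hsat i _).1 h1
  · obtain ⟨m, hm, hm'⟩ := hi
    simp only [Sat, tval, upd_upd] at h1
    refine (h1 m ?_ ((hsat i m).2 ⟨hm, hm'⟩)).elim
    rw [upd_ne _ _ (Nat.ne_of_gt hxy), upd_same]
    exact hm

/-! ## Łoś's theorem for bounded formulas -/

theorem UltraOn.compl_mem_iff {U : Set (Set S.M)} (hU : UltraOn S X U) {A : Set S.M}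
    (hA : A ∈ X) : Aᶜ ∈ U ↔ A ∉ U := by
  refine ⟨fun h h' => hU.empty_not_mem ?_, (hU.ultra A hA).resolve_left⟩
  simpa using hU.inter_mem _ h' _ h

variable {U : Set (Set S.M)}

/-- The valuation of number variables in the ultrapower represented by functions `f`. -/
def RUP.val (R : RUP S X U) (f : ℕ → Func S X) (k : ℕ) : R.K.M := R.cls (f k).1 (f k).2

theorem RUP.upd_val (R : RUP S X U) (f : ℕ → Func S X) (x : ℕ) (g : Func S X) :
    upd (R.val f) x (R.cls g.1 g.2) = R.val (upd f x g) :=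
  upd_comp (fun g : Func S X => R.cls g.1 g.2) f x g

theorem upd_apply (f : ℕ → Func S X) (x : ℕ) (g : Func S X) (i : S.M) :
    (fun k => (upd f x g k).1 i) = upd (fun k => (f k).1 i) x (g.1 i) :=
  (upd_comp (fun g : Func S X => g.1 i) f x g).symm

theorem RUP.tval_val (hRCA : RCA0 S X) (hne : X.Nonempty) (R : RUP S X U) (f : ℕ → Func S X)
    (t : Term) : tval R.K (R.val f) t = R.cls _ (hRCA.funcIn_tval hne f t) := by
  induction t with
  | var k => rfl
  | zero => exact R.zero_eq
  | one => exact R.one_eq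
  | add t u iht ihu =>
    simp only [tval, iht, ihu]
    exact R.add_eq _ _ _ _ _ _ fun _ => rfl
  | mul t u iht ihu =>
    simp only [tval, iht, ihu]
    exact R.mul_eq _ _ _ _ _ _ fun _ => rfl

/-- `φ` satisfies Łoś's theorem for the set parameters `w`. -/
def RUP.Los (R : RUP S X U) (w : ℕ → Set S.M) (φ : Fml) : Prop :=
  ∀ f : ℕ → Func S X, Sat R.K R.X2 (R.val f) (fun k => R.setImg (w k)) φ ↔
    {i | Sat S X (fun k => (f k).1 i) w φ} ∈ U

section Los

variable (hRCA : RCA0 S X) (hU : UltraOn S X U) {R : RUP S X U} {w : ℕ → Set S.M}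
  (hw : ∀ k, w k ∈ X) {φ ψ : Fml}
include hRCA hU hw

theorem RUP.Los.not (hφ : Delta0SO φ) (h : R.Los w φ) : R.Los w (.not φ) := fun f =>
  (not_congr (h f)).trans (hU.compl_mem_iff (hRCA.setOf_sat_mem hφ hw f)).symm

theorem RUP.Los.and (hφ : Delta0SO φ) (hψ : Delta0SO ψ) (h : R.Los w φ) (h' : R.Los w ψ) :
    R.Los w (.and φ ψ) := by
  refine fun f => (and_congr (h f) (h' f)).trans ⟨fun h => hU.inter_mem _ h.1 _ h.2, fun h => ?_⟩
  exact ⟨hU.superset_mem _ h _ (hRCA.setOf_sat_mem hφ hw f) fun _ => And.left,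
    hU.superset_mem _ h _ (hRCA.setOf_sat_mem hψ hw f) fun _ => And.right⟩

theorem RUP.Los.bex (hφ : Delta0SO φ) (h : R.Los w φ) (x : ℕ) (t : Term) :
    R.Los w (.bex x t φ) := by
  intro f
  have hin : ∀ g : Func S X, R.K.lt (R.cls g.1 g.2) (tval R.K (R.val f) t) ∧
      Sat R.K R.X2 (upd (R.val f) x (R.cls g.1 g.2)) (fun k => R.setImg (w k)) φ ↔
      {i | S.lt (g.1 i) (tval S (fun k => (f k).1 i) t)} ∈ U ∧
        {i | Sat S X (upd (fun k => (f k).1 i) x (g.1 i)) w φ} ∈ U := by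
    intro g
    rw [R.tval_val hRCA ⟨_, hw 0⟩, R.lt_iff, R.upd_val, h]
    simp only [upd_apply]
  constructor
  · rintro ⟨m, hm⟩
    obtain ⟨g, hg, rfl⟩ := R.surj m
    have := (hin ⟨g, hg⟩).1 hm
    exact hU.superset_mem _ (hU.inter_mem _ this.1 _ this.2) _
      (hRCA.setOf_sat_mem (.bex x t hφ) hw f) fun i hi => ⟨g i, hi⟩
  · intro hf
    obtain ⟨g, hg⟩ := hRCA.exists_func_bex hφ hw f x t
    refine ⟨R.cls g.1 g.2, (hin g).2 ⟨?_, ?_⟩⟩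
    · refine hU.superset_mem _ hf _ ?_ fun i hi => (hg i hi).1
      obtain ⟨N, hN⟩ := tval_support t
      have := hRCA.setOf_sat_mem (.lt (.var N) t) hw (upd f N g)
      simp only [upd_apply, Sat, tval, upd_same] at this
      convert this using 4 with i
      exact hN S _ _ fun k hk => (upd_ne (fun k => (f k).1 i) _ hk.ne).symm
    · refine hU.superset_mem _ hf _ ?_ fun i hi => (hg i hi).2
      simpa only [upd_apply] using hRCA.setOf_sat_mem hφ hw (upd f x g)

theorem RUP.Los.of_delta0SO (hφ : Delta0SO φ) : R.Los w φ := by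
  induction hφ with
  | eq t u =>
    intro f
    simp only [Sat, R.tval_val hRCA ⟨_, hw 0⟩, R.eq_iff]
  | lt t u =>
    intro f
    simp only [Sat, R.tval_val hRCA ⟨_, hw 0⟩, R.lt_iff]
  | mem t k =>
    intro f
    simp only [Sat, R.tval_val hRCA ⟨_, hw 0⟩, RUP.setImg, Set.mem_ofPred_eq,
      R.mem_iff _ _ _ (hw k)]
  | not hφ ih => exact ih.not hRCA hU hw hφ
  | and hφ hψ ih ih' => exact ih.and hRCA hU hw hφ hψ ih'
  | or hφ hψ ih ih' =>
    intro f
    have := ((ih.not hRCA hU hw hφ).and hRCA hU hw hφ.not hψ.not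
      (ih'.not hRCA hU hw hψ)).not hRCA hU hw (hφ.not.and hψ.not) f
    simpa only [Sat, ← not_or, not_not] using this
  | imp hφ hψ ih ih' =>
    intro f
    have := (ih.and hRCA hU hw hφ hψ.not
      (ih'.not hRCA hU hw hψ)).not hRCA hU hw (hφ.and hψ.not) f
    simpa only [Sat, not_and, not_not] using this
  | ball x t hφ ih =>
    intro f
    have := ((ih.not hRCA hU hw hφ).bex hRCA hU hw hφ.not x t).not hRCA hU hw
      (.bex x t hφ.not) f
    simpa only [Sat, not_exists, not_and, not_not] using this
  | bex x t hφ ih => exact ih.bex hRCA hU hw hφ x t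

end Los

end

/-! ## `Σ₂⁰`-elementarity -/

@[elab_as_elim]
theorem PiSO.induction_one {P : Fml → Prop} : ∀ {φ : Fml}, PiSO 1 φ →
    (∀ φ, Delta0SO φ → P φ) → (∀ x φ, P φ → P (.all x φ)) → P φ
  | _, .delta0 h, h0, _ => h0 _ h
  | _, .ofSigma (.delta0 h), h0, _ => h0 _ h
  | _, .all x h, h0, h1 => h1 x _ (h.induction_one h0 h1)

@[elab_as_elim]
theorem SigmaSO.induction_two {P : Fml → Prop} : ∀ {φ : Fml}, SigmaSO 2 φ →
    (∀ φ, PiSO 1 φ → P φ) → (∀ x φ, P φ → P (.ex x φ)) → P φ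
  | _, .delta0 h, h0, _ => h0 _ (.delta0 h)
  | _, .ofPi h, h0, _ => h0 _ h
  | _, .ex x h, h0, h1 => h1 x _ (h.induction_two h0 h1)

/-- A `Π₁⁰` formula `ψ` has bounded approximations `θ`, with bound a fresh variable `z`, which
follow from `ψ` and fail for large `z` if `ψ` fails. -/
theorem PiSO.exists_bounded {ψ : Fml} (hψ : PiSO 1 ψ) : ∃ N, ∀ z, N ≤ z → ∃ θ, Delta0SO θ ∧
    (∀ (S : Str) (X : Set (Set S.M)) v w c, Sat S X v w ψ → Sat S X (upd v z c) w θ) ∧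
    ∀ (S : Str) (X : Set (Set S.M)) v w, PAminus S → ¬ Sat S X v w ψ →
      ∃ b, ∀ b', ¬ S.lt b' b → ¬ Sat S X (upd v z b') w θ := by
  refine hψ.induction_one (fun φ hφ => ?_) fun x φ ih => ?_
  · obtain ⟨N, hN⟩ := hφ.exists_supp
    have hupd : ∀ (S : Str) (X : Set (Set S.M)) v w z c, N ≤ z →
        (Sat S X (upd v z c) w φ ↔ Sat S X v w φ) := fun S X v w z c hz =>
      hN S X _ _ _ _ (fun k hk => upd_ne _ _ (by omega)) fun _ _ => rfl
    exact ⟨N, fun z hz => ⟨φ, hφ, fun S X v w c => (hupd S X v w z c hz).2,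
      fun S X v w _ h => ⟨S.zero, fun b' _ => mt (hupd S X v w z b' hz).1 h⟩⟩⟩
  · obtain ⟨N, hN⟩ := ih
    refine ⟨max N (x + 1), fun z hz => ?_⟩
    obtain ⟨θ, hθ, h1, h2⟩ := hN z (by omega)
    have hzx : z ≠ x := by omega
    refine ⟨.ball x (.var z) θ, .ball _ _ hθ, fun S X v w c h m _ => ?_,
      fun S X v w hPA h => ?_⟩
    · rw [upd_comm _ hzx]
      exact h1 S X _ w c (h m)
    · simp only [Sat, not_forall] at h
      obtain ⟨m, hm⟩ := h
      obtain ⟨b, hb⟩ := h2 S X _ w hPA hm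
      let _ := hPA.linearOrder
      refine ⟨max b (S.add m S.one), fun b' hb' h' => ?_⟩
      have hle : max b (S.add m S.one) ≤ b' := not_lt.1 hb'
      refine hb b' (not_lt.2 ((le_max_left _ _).trans hle)) ?_
      rw [upd_comm _ hzx.symm]
      refine h' m ?_
      rw [show tval S (upd v z b') (.var z) = b' from upd_same _ _ _]
      have hlt : m < S.add m S.one := (hPA.lt_succ_iff _ _).2 (.inr rfl)
      exact hlt.trans_le ((le_max_right _ _).trans hle)

section

variable {S : Str} {X U : Set (Set S.M)} (hRCA : RCA0 S X) (hU : UltraOn S X U) (R : RUP S X U)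
  {w : ℕ → Set S.M} (hw : ∀ k, w k ∈ X)
include hRCA hU hw

theorem RUP.sat_pi_of_forall {ψ : Fml} (hψ : PiSO 1 ψ) : ∀ f : ℕ → Func S X,
    (∀ i, Sat S X (fun k => (f k).1 i) w ψ) →
      Sat R.K R.X2 (R.val f) (fun k => R.setImg (w k)) ψ := by
  refine hψ.induction_one (fun φ hφ f h => ?_) fun x φ ih f h m => ?_
  · rw [RUP.Los.of_delta0SO hRCA hU hw hφ, Set.eq_univ_of_forall (s := {i | _}) h]
    exact hU.univ_mem
  · obtain ⟨g, hg, rfl⟩ := R.surj m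
    rw [R.upd_val f x ⟨g, hg⟩]
    refine ih _ fun i => ?_
    rw [upd_apply]
    exact h i (g i)

theorem RUP.exists_sat_of_sat_pi {ψ : Fml} (hψ : PiSO 1 ψ) (f : ℕ → Func S X)
    (h : Sat R.K R.X2 (R.val f) (fun k => R.setImg (w k)) ψ) :
    ∃ i, Sat S X (fun k => (f k).1 i) w ψ := by
  by_contra! hn
  obtain ⟨N, hN⟩ := hψ.exists_bounded
  obtain ⟨θ, hθ, h1, h2⟩ := hN N le_rfl
  obtain ⟨g, hg⟩ := hRCA.exists_func hθ.not hw f N fun i => by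
    obtain ⟨b, hb⟩ := h2 S X _ w hRCA.1 (hn i)
    exact ⟨b, hb b (hRCA.1.lt_irrefl b)⟩
  have h3 := h1 R.K R.X2 _ _ (R.cls g.1 g.2) h
  rw [R.upd_val, RUP.Los.of_delta0SO hRCA hU hw hθ] at h3
  refine hU.empty_not_mem ?_
  convert h3 using 1
  refine (Set.eq_empty_of_forall_notMem fun i hi => hg i ?_).symm
  rwa [← upd_apply]

theorem RUP.exists_sat_of_sat_sigma {φ : Fml} (hφ : SigmaSO 2 φ) : ∀ f : ℕ → Func S X,
    Sat R.K R.X2 (R.val f) (fun k => R.setImg (w k)) φ →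
      ∃ i, Sat S X (fun k => (f k).1 i) w φ := by
  refine hφ.induction_two (fun ψ hψ => R.exists_sat_of_sat_pi hRCA hU hw hψ) ?_
  rintro x φ ih f ⟨m, hm⟩
  obtain ⟨g, hg, rfl⟩ := R.surj m
  rw [R.upd_val f x ⟨g, hg⟩] at hm
  obtain ⟨i, hi⟩ := ih _ hm
  rw [upd_apply] at hi
  exact ⟨i, g i, hi⟩

theorem RUP.sat_emb_of_sat_sigma {φ : Fml} (hφ : SigmaSO 2 φ) : ∀ v : ℕ → S.M,
    Sat S X v w φ → Sat R.K R.X2 (fun k => R.emb (v k)) (fun k => R.setImg (w k)) φ := by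
  refine hφ.induction_two (fun ψ hψ v h => ?_) ?_
  · exact R.sat_pi_of_forall hRCA hU hw hψ (fun k => ⟨_, R.const_in (v k)⟩) fun _ => h
  · rintro x φ ih v ⟨m, hm⟩
    refine ⟨R.emb m, ?_⟩
    rw [upd_comp R.emb]
    exact ih _ hm

end

end PaperArith

namespace PaperArith

/-- Corollary `cor:2ndele`.
Let `(M, 𝒳) ⊨ RCA₀`, `ℱ` the class of total functions `M → M` in `𝒳`, and
`𝒰` an ultrafilter on `𝒳` all of whose elements are cofinal in `M`.  Then
the second-order restricted ultrapower `(ℱ/𝒰, 𝒳)` is a `Σ₂⁰`-elementary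
extension of `(M, 𝒳)`. -/
theorem statement_2 (S : Str) (X U : Set (Set S.M))
    (hRCA : RCA0 S X) (hU : UltraOn S X U) (R : RUP S X U) :
    ∀ φ : Fml, SigmaSO 2 φ →
      ∀ (v : ℕ → S.M) (w : ℕ → Set S.M), (∀ k, w k ∈ X) →
        (Sat S X v w φ ↔
          Sat R.K R.X2 (fun k => R.emb (v k)) (fun k => R.setImg (w k)) φ) := by
  intro φ hφ v w hw
  refine ⟨R.sat_emb_of_sat_sigma hRCA hU hw hφ v, fun h => ?_⟩
  exact (R.exists_sat_of_sat_sigma hRCA hU hw hφ (fun k => ⟨_, R.const_in (v k)⟩) h).elim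
    fun _ => id

end PaperArith
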